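/- arXiv:2412.10301 — 3 statements merged into one kernel-verified Lean document; each statement's English description precedes it below -/
import Mathlib

section
/- Let V be a real vector space carrying a quaternionic triple (I₁,I₂,I₃), let γ ∈ V* and Y ∈ V. Then the commutator of the quaternionic bracket endomorphism ⟨Y,γ⟩_q with I₁ is given explicitly by ⟨Y,γ⟩_q ∘ I₁ − I₁ ∘ ⟨Y,γ⟩_q = γ(I₂Y)·I₃ − γ(I₃Y)·I₂. -/
open Module

variable {V : Type*} [AddCommGroup V] [Module ℝ V]

/-- The quaternionic bracket `⟨Y,γ⟩_q : Z ↦ ½(γ(Y)Z + γ(Z)Y − Σᵢ (γ(IᵢY)IᵢZ + γ(IᵢZ)IᵢY))`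
as an endomorphism of `V`. -/
noncomputable def qBracket (I₁ I₂ I₃ : Module.End ℝ V) (γ : Module.Dual ℝ V) (Y : V) :
    Module.End ℝ V :=
  (1/2 : ℝ) • (γ Y • (1 : Module.End ℝ V) + γ.smulRight Y
    - (γ (I₁ Y) • I₁ + (γ ∘ₗ I₁).smulRight (I₁ Y)
      + γ (I₂ Y) • I₂ + (γ ∘ₗ I₂).smulRight (I₂ Y)
      + γ (I₃ Y) • I₃ + (γ ∘ₗ I₃).smulRight (I₃ Y)))

/-- The commutator of the quaternionic bracket with `I₁` is `γ(I₂Y)·I₃ − γ(I₃Y)·I₂`. -/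
theorem qBracket_commutator_eq (I₁ I₂ I₃ : Module.End ℝ V)
    (h1 : I₁ * I₁ = -1) (h2 : I₂ * I₂ = -1) (h3 : I₃ * I₃ = -1)
    (h12 : I₁ * I₂ = -(I₂ * I₁)) (h13 : I₁ * I₃ = -(I₃ * I₁)) (h23 : I₂ * I₃ = -(I₃ * I₂))
    (h123 : I₁ * I₂ = I₃)
    (γ : Module.Dual ℝ V) (Y : V) :
    qBracket I₁ I₂ I₃ γ Y * I₁ - I₁ * qBracket I₁ I₂ I₃ γ Y
      = γ (I₂ Y) • I₃ - γ (I₃ Y) • I₂ := by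
  have e11 : ∀ Z, I₁ (I₁ Z) = -Z := fun Z => by simpa using LinearMap.congr_fun h1 Z
  have e12 : ∀ Z, I₁ (I₂ Z) = I₃ Z := fun Z => by simpa using LinearMap.congr_fun h123 Z
  have e21 : ∀ Z, I₂ (I₁ Z) = -I₃ Z := fun Z => by
    have h : I₁ (I₂ Z) = -(I₂ (I₁ Z)) := by simpa using LinearMap.congr_fun h12 Z
    rw [← e12, h, neg_neg]
  have e13 : ∀ Z, I₁ (I₃ Z) = -I₂ Z := fun Z => by rw [← e12, e11]
  have e31 : ∀ Z, I₃ (I₁ Z) = I₂ Z := fun Z => by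
    have h : I₁ (I₃ Z) = -(I₃ (I₁ Z)) := by simpa using LinearMap.congr_fun h13 Z
    rw [e13] at h
    exact (neg_injective h).symm
  ext Z
  simp only [qBracket, LinearMap.sub_apply, Module.End.mul_apply, LinearMap.smul_apply,
    LinearMap.add_apply, LinearMap.smulRight_apply, LinearMap.comp_apply, Module.End.one_apply,
    map_sub, map_add, map_smul, map_neg, e11, e12, e21, e13, e31]
  module
end

section
/- Let V be a real vector space carrying a quaternionic triple (I₁,I₂,I₃), let γ ∈ V* and Y ∈ V. Then for each i ∈ {1,2,3}, the commutator ⟨Y,γ⟩_q ∘ Iᵢ − Iᵢ ∘ ⟨Y,γ⟩_q lies in the real linear span of {I₁, I₂, I₃} inside End(V). (Hence modifying a quaternionic connection by the bracket term again preserves the quaternionic bundle Q.) -/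
open Module

variable {V : Type*} [AddCommGroup V] [Module ℝ V]

/-- For each `Iᵢ` in the quaternionic triple, the commutator of the quaternionic bracket
with `Iᵢ` lies in the real span of `{I₁, I₂, I₃}` inside `End(V)`. -/
theorem qBracket_commutator_mem_span (I₁ I₂ I₃ : Module.End ℝ V)
    (h1 : I₁ * I₁ = -1) (h2 : I₂ * I₂ = -1) (h3 : I₃ * I₃ = -1)
    (h12 : I₁ * I₂ = -(I₂ * I₁)) (h13 : I₁ * I₃ = -(I₃ * I₁)) (h23 : I₂ * I₃ = -(I₃ * I₂))
    (h123 : I₁ * I₂ = I₃)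
    (γ : Module.Dual ℝ V) (Y : V) :
    ∀ I ∈ ({I₁, I₂, I₃} : Set (Module.End ℝ V)),
      qBracket I₁ I₂ I₃ γ Y * I - I * qBracket I₁ I₂ I₃ γ Y
        ∈ Submodule.span ℝ ({I₁, I₂, I₃} : Set (Module.End ℝ V)) := by
  have h21 : I₂ * I₁ = -I₃ := by rw [← h123, h12, neg_neg]
  have h31 : I₃ * I₁ = I₂ := by
    have e : I₁ * I₃ = -I₂ := by rw [← h123, ← mul_assoc, h1, neg_one_mul]
    rw [h13] at e
    exact neg_injective e
  have h32 : I₃ * I₂ = -I₁ := by rw [← h123, mul_assoc, h2, mul_neg_one]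
  rw [h31] at h13
  rw [h32, neg_neg] at h23
  have a11 : ∀ v, I₁ (I₁ v) = -v := fun v => LinearMap.congr_fun h1 v
  have a22 : ∀ v, I₂ (I₂ v) = -v := fun v => LinearMap.congr_fun h2 v
  have a33 : ∀ v, I₃ (I₃ v) = -v := fun v => LinearMap.congr_fun h3 v
  have a12 : ∀ v, I₁ (I₂ v) = I₃ v := fun v => LinearMap.congr_fun h123 v
  have a21 : ∀ v, I₂ (I₁ v) = -I₃ v := fun v => LinearMap.congr_fun h21 v
  have a13 : ∀ v, I₁ (I₃ v) = -I₂ v := fun v => LinearMap.congr_fun h13 v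
  have a31 : ∀ v, I₃ (I₁ v) = I₂ v := fun v => LinearMap.congr_fun h31 v
  have a23 : ∀ v, I₂ (I₃ v) = I₁ v := fun v => LinearMap.congr_fun h23 v
  have a32 : ∀ v, I₃ (I₂ v) = -I₁ v := fun v => LinearMap.congr_fun h32 v
  intro I hI
  rw [Submodule.mem_span_triple]
  rcases hI with rfl | rfl | rfl
  · refine ⟨0, -γ (I₃ Y), γ (I₂ Y), ?_⟩
    ext Z
    simp [qBracket, a11, a22, a33, a12, a21, a13, a31, a23, a32]
    module
  · refine ⟨γ (I₃ Y), 0, -γ (I₁ Y), ?_⟩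
    ext Z
    simp [qBracket, a11, a22, a33, a12, a21, a13, a31, a23, a32]
    module
  · refine ⟨-γ (I₂ Y), γ (I₁ Y), 0, ?_⟩
    ext Z
    simp [qBracket, a11, a22, a33, a12, a21, a13, a31, a23, a32]
    module
end

section
/- Let V be a nonzero finite-dimensional real vector space carrying a quaternionic triple (I₁,I₂,I₃), and let γ ∈ V*. If the quaternionic bracket ⟨Y,γ⟩_q is the zero endomorphism for every Y ∈ V, then γ = 0. Hence the map γ ↦ ⟨·,γ⟩_q from V* to bilinear modifications is injective, so the quaternionic connections form an affine space modeled on 1-forms. -/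
open Module

variable {V : Type*} [AddCommGroup V] [Module ℝ V]

/-- If `⟨Y,γ⟩_q = 0` for all `Y` then `γ = 0`; hence `γ ↦ ⟨·,γ⟩_q` is injective and the
quaternionic connections form an affine space modeled on 1-forms. -/
theorem qBracket_eq_zero_iff [FiniteDimensional ℝ V] [Nontrivial V]
    (I₁ I₂ I₃ : Module.End ℝ V)
    (h1 : I₁ * I₁ = -1) (h2 : I₂ * I₂ = -1) (h3 : I₃ * I₃ = -1)
    (h12 : I₁ * I₂ = -(I₂ * I₁)) (h13 : I₁ * I₃ = -(I₃ * I₁)) (h23 : I₂ * I₃ = -(I₃ * I₂))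
    (h123 : I₁ * I₂ = I₃)
    (γ : Module.Dual ℝ V)
    (h : ∀ Y : V, qBracket I₁ I₂ I₃ γ Y = 0) :
    γ = 0 := by
  have key : ∀ Y : V, γ Y ^ 2 = γ (I₁ Y) ^ 2 + γ (I₂ Y) ^ 2 + γ (I₃ Y) ^ 2 := by
    intro Y
    have e := congrArg γ (LinearMap.congr_fun (h Y) Y)
    simp [qBracket] at e
    linarith
  have a1 : ∀ Y, I₁ (I₁ Y) = -Y := fun Y => by simpa using LinearMap.congr_fun h1 Y
  have a2 : ∀ Y, I₂ (I₂ Y) = -Y := fun Y => by simpa using LinearMap.congr_fun h2 Y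
  have a12 : ∀ Y, I₁ (I₂ Y) = I₃ Y := fun Y => by simpa using LinearMap.congr_fun h123 Y
  have a21 : ∀ Y, I₂ (I₁ Y) = -I₃ Y := fun Y => by
    have e := LinearMap.congr_fun h12 Y
    simp only [Module.End.mul_apply, LinearMap.neg_apply] at e
    rw [← a12, e, neg_neg]
  have a31 : ∀ Y, I₃ (I₁ Y) = I₂ Y := fun Y => by
    rw [← a12, a21, map_neg, ← a12, a1, neg_neg]
  have a32 : ∀ Y, I₃ (I₂ Y) = -I₁ Y := fun Y => by
    rw [← a12, a2, map_neg]
  ext Y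
  have k0 := key Y
  have k1 := key (I₁ Y)
  have k2 := key (I₂ Y)
  simp only [a1, a2, a12, a21, a31, a32, map_neg, neg_sq] at k1 k2
  have : γ Y ^ 2 = 0 := by
    nlinarith [sq_nonneg (γ Y), sq_nonneg (γ (I₁ Y)), sq_nonneg (γ (I₂ Y)), sq_nonneg (γ (I₃ Y))]
  simpa using this
end
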